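/- A 3-uniform hypergraph F satisfies condition (♠) if and only if there exists a labeling σ of V(F) such that for every vertex v ∈ V(F) the link graph L_F(v) contains no monotone P3 with respect to σ. -/

import Mathlib

open Filter

/-- A 3-uniform hypergraph on vertex type `V`: a set of edges, each of size 3. -/
structure H3 (V : Type) [DecidableEq V] where
  edges : Finset (Finset V)
  card3 : ∀ e ∈ edges, e.card = 3

namespace H3

variable {V W : Type} [DecidableEq V] [DecidableEq W]

/-- `H` contains a copy of `F`: an injection of vertices mapping edges to edges. -/
def contains (H : H3 V) (F : H3 W) : Prop :=
  ∃ f : W → V, Function.Injective f ∧ ∀ e ∈ F.edges, e.image f ∈ H.edges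

/-- `H` is `F`-free. -/
def free (H : H3 V) (F : H3 W) : Prop := ¬ H.contains F

/-- The codegree of a pair of vertices: the number of edges containing both. -/
def codeg (H : H3 V) (u v : V) : ℕ :=
  (H.edges.filter fun e => u ∈ e ∧ v ∈ e).card

/-- The minimum codegree: the minimum of `codeg` over pairs of distinct vertices. -/
noncomputable def minCodeg [Fintype V] (H : H3 V) : ℕ :=
  sInf {d | ∃ u v : V, u ≠ v ∧ H.codeg u v = d}

/-- `H` is uniformly `(d, η)`-dense: every vertex subset `U` spans at least
`d * C(|U|,3) - η * n^3` edges. -/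
def uniformlyDense [Fintype V] (H : H3 V) (d η : ℝ) : Prop :=
  ∀ U : Finset V,
    d * (U.card.choose 3 : ℝ) - η * (Fintype.card V : ℝ) ^ 3
      ≤ ((H.edges.filter fun e => e ⊆ U).card : ℝ)

end H3

/-- The uniform Turán density `π_⋅(F)`. -/
noncomputable def uniformTuranDensity {W : Type} [DecidableEq W] (F : H3 W) : ℝ :=
  sSup {d : ℝ | 0 ≤ d ∧ d ≤ 1 ∧
    ∀ η : ℝ, 0 < η → ∀ n₀ : ℕ, ∃ n, n₀ ≤ n ∧
      ∃ H : H3 (Fin n), H.free F ∧ H.uniformlyDense d η}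

/-- The codegree Turán number `ex_co(n, F)`: the maximum minimum codegree of an
`n`-vertex `F`-free 3-graph. -/
noncomputable def exCodeg {W : Type} [DecidableEq W] (n : ℕ) (F : H3 W) : ℕ :=
  sSup {d | ∃ H : H3 (Fin n), H.free F ∧ H.minCodeg = d}

/-- The codegree Turán density `π_co(F) = lim_n ex_co(n,F)/n` (the limit exists,
so it coincides with the limsup). -/
noncomputable def codegTuranDensity {W : Type} [DecidableEq W] (F : H3 W) : ℝ :=
  Filter.limsup (fun n : ℕ => (exCodeg n F : ℝ) / n) Filter.atTop

/-- Condition (♠): there is an enumeration of the vertices and a 3-colouring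
`φ` of pairs (colours `0 = red`, `1 = blue`, `2 = green`) such that every edge
`{a,b,c}` with `σ a < σ b < σ c` satisfies `φ a b = red`, `φ a c = blue`,
`φ b c = green`. -/
def Spade {V : Type} [DecidableEq V] [Fintype V] (H : H3 V) : Prop :=
  ∃ σ : V ≃ Fin (Fintype.card V), ∃ φ : V → V → Fin 3,
    (∀ u v : V, φ u v = φ v u) ∧
    ∀ a b c : V, ({a, b, c} : Finset V) ∈ H.edges → σ a < σ b → σ b < σ c →
      φ a b = 0 ∧ φ a c = 1 ∧ φ b c = 2

/-- The link graph of `v` in `F` contains a monotone `P₃` with respect to the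
injection `σ` of the vertices into `ℕ`: a path `x y z` (i.e. `{x,y}` and
`{y,z}` are link edges, `x ≠ z`) with `σ x < σ y < σ z` or `σ x > σ y > σ z`. -/
def hasMonoP3 {V : Type} [DecidableEq V] (F : H3 V) (v : V) (σ : V → ℕ) : Prop :=
  ∃ x y z : V, ({x, y, v} : Finset V) ∈ F.edges ∧ ({y, z, v} : Finset V) ∈ F.edges ∧
    x ≠ z ∧ ((σ x < σ y ∧ σ y < σ z) ∨ (σ z < σ y ∧ σ y < σ x))

/-- A labeling with an admissible 3-colouring admits no increasing path of length two in a link. -/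
theorem not_increasing_path_of_colouring {V : Type} [DecidableEq V] (F : H3 V) (σ : V → ℕ)
    (hσ : Function.Injective σ) (φ : V → V → Fin 3) (hsymm : ∀ u v : V, φ u v = φ v u)
    (hφ : ∀ a b c : V, ({a, b, c} : Finset V) ∈ F.edges → σ a < σ b → σ b < σ c →
      φ a b = 0 ∧ φ a c = 1 ∧ φ b c = 2)
    {x y z v : V} (hxy : ({x, y, v} : Finset V) ∈ F.edges)
    (hyz : ({y, z, v} : Finset V) ∈ F.edges) (lxy : σ x < σ y) (lyz : σ y < σ z) : False := by
  have ne_of_edge : ∀ a b c : V, ({a, b, c} : Finset V) ∈ F.edges → a ≠ c ∧ b ≠ c := by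
    intro a b c h
    have h₃ := F.card3 _ h
    constructor <;> rintro rfl
    · have := Finset.card_le_two (a := b) (b := a)
      simp_all
    · have := Finset.card_le_two (a := a) (b := b)
      simp_all
  have hxv : σ x ≠ σ v := hσ.ne (ne_of_edge _ _ _ hxy).1
  have hyv : σ y ≠ σ v := hσ.ne (ne_of_edge _ _ _ hxy).2
  have hzv : σ z ≠ σ v := hσ.ne (ne_of_edge _ _ _ hyz).2
  have e₁ : ({x, v, y} : Finset V) ∈ F.edges := by rwa [Finset.pair_comm v y]
  have e₂ : ({v, x, y} : Finset V) ∈ F.edges := by rwa [Finset.insert_comm v x]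
  have e₃ : ({y, v, z} : Finset V) ∈ F.edges := by rwa [Finset.pair_comm v z]
  have e₄ : ({v, y, z} : Finset V) ∈ F.edges := by rwa [Finset.insert_comm v y]
  have := hsymm y v
  have := hφ _ _ _ hxy
  have := hφ _ _ _ hyz
  have := hφ _ _ _ e₁
  have := hφ _ _ _ e₂
  have := hφ _ _ _ e₃
  have := hφ _ _ _ e₄
  grind

open Classical in
/-- The colour of a pair read off from the position of a third vertex completing it to an edge:
red if the third vertex can come last, green if it can come first, and blue otherwise. -/
noncomputable def H3.positionColour {V : Type} [DecidableEq V] (F : H3 V) (σ : V → ℕ)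
    (u v : V) : Fin 3 :=
  if ∃ w, ({u, v, w} : Finset V) ∈ F.edges ∧ σ u < σ w ∧ σ v < σ w then 0
  else if ∃ w, ({u, v, w} : Finset V) ∈ F.edges ∧ σ w < σ u ∧ σ w < σ v then 2
  else 1

theorem H3.positionColour_comm {V : Type} [DecidableEq V] (F : H3 V) (σ : V → ℕ) (u v : V) :
    F.positionColour σ u v = F.positionColour σ v u := by
  have hs : ∀ w, ({u, v, w} : Finset V) = {v, u, w} := fun w => Finset.insert_comm u v {w}
  have hl : ∀ w, σ u < σ w ∧ σ v < σ w ↔ σ v < σ w ∧ σ u < σ w := fun _ => and_comm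
  have hg : ∀ w, σ w < σ u ∧ σ w < σ v ↔ σ w < σ v ∧ σ w < σ u := fun _ => and_comm
  classical
  refine if_congr (exists_congr fun w => ?_) rfl (if_congr (exists_congr fun w => ?_) rfl rfl)
  · rw [hs, hl]
  · rw [hs, hg]

/-- If no link graph has a monotone path of length two, the position colouring is admissible. -/
theorem H3.positionColour_of_edge {V : Type} [DecidableEq V] (F : H3 V) (σ : V → ℕ)
    (h : ∀ v, ¬ hasMonoP3 F v σ) {a b c : V} (habc : ({a, b, c} : Finset V) ∈ F.edges)
    (hab : σ a < σ b) (hbc : σ b < σ c) :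
    F.positionColour σ a b = 0 ∧ F.positionColour σ a c = 1 ∧ F.positionColour σ b c = 2 := by
  have key : ∀ x y z v : V, ({x, y, v} : Finset V) ∈ F.edges →
      ({y, z, v} : Finset V) ∈ F.edges → σ x < σ y → σ y < σ z → False :=
    fun x y z v h₁ h₂ l₁ l₂ =>
      h v ⟨x, y, z, h₁, h₂, fun e => by subst e; omega, Or.inl ⟨l₁, l₂⟩⟩
  have rot : ∀ x y z : V, ({x, y, z} : Finset V) = {y, z, x} := fun x y z => by
    rw [Finset.insert_comm, Finset.pair_comm x z]
  have hbca : ({b, c, a} : Finset V) ∈ F.edges := rot a b c ▸ habc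
  have hbac : ({b, a, c} : Finset V) ∈ F.edges := Finset.insert_comm a b {c} ▸ habc
  refine ⟨if_pos ⟨c, habc, hab.trans hbc, hbc⟩, ?_, ?_⟩
  · rw [H3.positionColour, if_neg, if_neg]
    · rintro ⟨w, hw, lwa, -⟩
      exact key w a b c (by rwa [rot]) habc lwa hab
    · rintro ⟨w, hw, -, lcw⟩
      exact key b c w a hbca (by rwa [← rot]) hbc lcw
  · rw [H3.positionColour, if_neg, if_pos ⟨a, hbca, hab, hab.trans hbc⟩]
    rintro ⟨w, hw, -, lcw⟩
    refine key a c w b (by rwa [← rot]) (by rwa [← rot]) (hab.trans hbc) lcw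

/-- `F` satisfies condition (♠) if and only if there is a labeling `σ` of
`V(F)` such that no link graph of `F` contains a monotone `P₃` w.r.t. `σ`. -/
theorem stmt4 {V : Type} [DecidableEq V] [Fintype V] (F : H3 V) :
    Spade F ↔ ∃ σ : V ≃ Fin (Fintype.card V), ∀ v : V,
      ¬ hasMonoP3 F v (fun x => ((σ x : Fin (Fintype.card V)) : ℕ)) := by
  constructor
  · rintro ⟨σ, φ, hsymm, hφ⟩
    refine ⟨σ, ?_⟩
    rintro v ⟨x, y, z, hxy, hyz, -, ⟨h₁, h₂⟩ | ⟨h₁, h₂⟩⟩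
    · exact not_increasing_path_of_colouring F (fun x => (σ x : ℕ))
        (Fin.val_injective.comp σ.injective) φ hsymm hφ hxy hyz h₁ h₂
    · rw [Finset.insert_comm] at hxy hyz
      exact not_increasing_path_of_colouring F (fun x => (σ x : ℕ))
        (Fin.val_injective.comp σ.injective) φ hsymm hφ hyz hxy h₁ h₂
  · rintro ⟨σ, h⟩
    exact ⟨σ, F.positionColour fun x => (σ x : ℕ), F.positionColour_comm _,
      fun _ _ _ e h₁ h₂ => F.positionColour_of_edge _ h e h₁ h₂⟩
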